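/- arXiv:1504.00201 — 13 statements merged into one kernel-verified Lean document; each statement's English description precedes it below -/
import Mathlib

section
/- In the single-product Fixed-case lot-sizing model, every cyclic schedule has length divisible by p / gcd(p,d): if a production pattern x : ℕ → Bool with initial stock q 0 = q0 satisfies q l = q 0 for a positive integer l (where q (t+1) = q t + (if x t then p else 0) − d), then (p / gcd(p,d)) divides l. -/
/-- The stock after `t` steps differs from the initial stock minus the accumulated demand by a
multiple of the production quantity. -/
lemma dvd_stock_sub_add_mul (p d : ℤ) (x : ℕ → Bool) (q : ℕ → ℤ)
    (hrec : ∀ t, q (t + 1) = q t + (if x t then p else 0) - d) (t : ℕ) :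
    p ∣ q t - q 0 + t * d := by
  induction t with
  | zero => simp
  | succ t ih =>
    have hstep : q (t + 1) - q 0 + ((t + 1 : ℕ) : ℤ) * d =
        q t - q 0 + t * d + (if x t then p else 0) := by
      rw [hrec]; push_cast; ring
    rw [hstep]
    refine dvd_add ih ?_
    split_ifs <;> simp

/-- Single-product Fixed-case lot-sizing: every cyclic schedule has length divisible by
`p / gcd p d`. -/
theorem stmt_0 (p d : ℕ) (hd : 0 < d) (hdp : d ≤ p)
    (q0 : ℤ) (hq0nonneg : 0 ≤ q0) (x : ℕ → Bool) (q : ℕ → ℤ)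
    (hq0 : q 0 = q0)
    (hrec : ∀ t, q (t + 1) = q t + (if x t then (p : ℤ) else 0) - d)
    (l : ℕ) (hl : 0 < l) (hcyc : q l = q 0) :
    (p / Nat.gcd p d) ∣ l := by
  have hdvd : p ∣ l * d := by
    have h := dvd_stock_sub_add_mul p d x q hrec l
    rw [hcyc, sub_self, zero_add] at h
    exact_mod_cast h
  have hg : 0 < Nat.gcd p d := Nat.gcd_pos_of_pos_right p hd
  refine (Nat.coprime_div_gcd_div_gcd hg).dvd_of_dvd_mul_right ?_
  rw [← Nat.mul_div_assoc l (Nat.gcd_dvd_right p d)]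
  exact Nat.div_dvd_div (Nat.gcd_dvd_left p d) hdvd
end

section
/- In the single-product Fixed-case lot-sizing model, the minimum cycle length is p / gcd(p,d): the least positive integer l for which there exist an initial stock q0 ≥ 0 and a production pattern x : ℕ → Bool forming a feasible cyclic schedule of length l equals p / gcd(p,d). -/
/-- Subtracting `d ∈ [0, p]` from a residue modulo `p` wraps around exactly when the residue is
below `d`. -/
theorem Int.sub_emod_eq_ite {p d : ℤ} (hp : 0 < p) (hd : 0 ≤ d) (hdp : d ≤ p) (a : ℤ) :
    (a - d) % p = a % p + (if a % p < d then p else 0) - d := by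
  have h0 := Int.emod_nonneg a hp.ne'
  have h1 := Int.emod_lt_of_pos a hp
  rw [← Int.emod_sub_emod]
  split_ifs with h
  · rw [← Int.add_emod_right, Int.emod_eq_of_lt (by omega) (by omega)]
    ring
  · rw [Int.emod_eq_of_lt (by omega) (by omega)]
    ring

/-- The stock after `t` periods is the initial stock minus total demand, modulo `p`. -/
theorem dvd_stock_sub {p d : ℤ} {x : ℕ → Bool} {q : ℕ → ℤ}
    (hq : ∀ t, q (t + 1) = q t + (if x t then p else 0) - d) (t : ℕ) :
    p ∣ q t - q 0 + d * t := by
  induction t with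
  | zero => simp
  | succ t ih =>
    have h : q (t + 1) - q 0 + d * ((t + 1 : ℕ) : ℤ)
        = (q t - q 0 + d * t) + (if x t then p else 0) := by
      rw [hq]
      push_cast
      ring
    rw [h]
    refine dvd_add ih ?_
    split_ifs <;> simp

theorem Nat.div_gcd_dvd_of_dvd_mul {p d l : ℕ} (hp : 0 < p) (h : p ∣ d * l) :
    p / Nat.gcd p d ∣ l := by
  have hg : 0 < Nat.gcd p d := Nat.gcd_pos_of_pos_left d hp
  refine (Nat.coprime_div_gcd_div_gcd hg).dvd_of_dvd_mul_left ?_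
  rw [Nat.div_mul_right_comm (Nat.gcd_dvd_right p d)]
  exact Nat.div_dvd_div (Nat.gcd_dvd_left p d) h

/-- Single-product Fixed-case lot-sizing: the minimum cycle length over all feasible
cyclic schedules equals `p / gcd p d`. -/
theorem stmt_1 (p d : ℕ) (hd : 0 < d) (hdp : d ≤ p) :
    IsLeast { l : ℕ | 0 < l ∧ ∃ (q0 : ℤ) (x : ℕ → Bool) (q : ℕ → ℤ),
        0 ≤ q0 ∧ q 0 = q0 ∧
        (∀ t, q (t + 1) = q t + (if x t then (p : ℤ) else 0) - d) ∧
        (∀ t ≤ l, 0 ≤ q t) ∧ q l = q 0 }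
      (p / Nat.gcd p d) := by
  have hp : 0 < p := hd.trans_le hdp
  have hpz : (0 : ℤ) < p := by exact_mod_cast hp
  refine ⟨⟨Nat.div_pos (Nat.gcd_le_left d hp) (Nat.gcd_pos_of_pos_left d hp), 0,
    fun t => decide ((-(d * t : ℤ)) % p < d), fun t => (-(d * t : ℤ)) % p, le_rfl, by simp,
    fun t => ?_, fun t _ => Int.emod_nonneg _ hpz.ne', ?_⟩, ?_⟩
  · have h := Int.sub_emod_eq_ite hpz (Int.natCast_nonneg d) (by exact_mod_cast hdp)
      (-(d * t : ℤ))
    simp only [decide_eq_true_eq]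
    rw [← h]
    congr 1
    push_cast
    ring
  · have h : p ∣ d * (p / Nat.gcd p d) := by
      rw [← Nat.mul_div_assoc d (Nat.gcd_dvd_left p d),
        Nat.mul_div_right_comm (Nat.gcd_dvd_right p d)]
      exact dvd_mul_left _ _
    have hz : (p : ℤ) ∣ -((d : ℤ) * ((p / Nat.gcd p d : ℕ) : ℤ)) :=
      (dvd_neg).2 (by exact_mod_cast h)
    simpa using Int.emod_eq_zero_of_dvd hz
  · rintro l ⟨hl, _, x, q, _, _, hq, _, hc⟩
    have h := dvd_stock_sub hq l
    rw [hc, sub_self, zero_add] at h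
    exact Nat.le_of_dvd hl (Nat.div_gcd_dvd_of_dvd_mul hp (by exact_mod_cast h))
end

section
/- In the single-product Fixed-case lot-sizing model, the greedy schedule's stock admits the closed form q t = (−d·t) mod p for all t ∈ ℕ (the representative in [0, p) of −d·t modulo p). -/
/-- Single-product Fixed-case lot-sizing: the greedy schedule's stock admits the closed
form `q t = (-d * t) % p`. -/
theorem stmt_2 (p d : ℕ) (hd : 0 < d) (hdp : d ≤ p)
    (q : ℕ → ℤ) (hq0 : q 0 = 0)
    (hrec : ∀ t, q (t + 1) = if q t < d then q t + p - d else q t - d) :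
    ∀ t, q t = (-(d : ℤ) * t) % p := by
  have hinv : ∀ t, 0 ≤ q t ∧ q t < p ∧ q t ≡ -(d : ℤ) * t [ZMOD p] := by
    intro t
    induction t with
    | zero =>
      refine ⟨hq0.ge, by omega, ?_⟩
      simp [hq0, Int.ModEq.refl]
    | succ t ih =>
      obtain ⟨h0, hlt, hmod⟩ := ih
      have hstep : q t - d ≡ -(d : ℤ) * (t + 1 : ℕ) [ZMOD p] := by
        convert hmod.sub_right (d : ℤ) using 1
        push_cast
        ring
      rw [hrec t]
      split_ifs with h
      · refine ⟨by omega, by omega, ?_⟩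
        rw [add_sub_right_comm]
        exact Int.add_modEq_right.trans hstep
      · exact ⟨by omega, by omega, hstep⟩
  intro t
  obtain ⟨h0, hlt, hmod⟩ := hinv t
  rw [← hmod.eq, Int.emod_eq_of_lt h0 hlt]
end

section
/- In the single-product Fixed-case lot-sizing model, the greedy schedule is a feasible cyclic schedule of length p / gcd(p,d): its stock satisfies 0 ≤ q t < p for all t, and q (t + p / gcd(p,d)) = q t for all t ∈ ℕ. -/
theorem greedyStock_bounds {p d : ℕ} (hd : 0 < d) (hdp : d ≤ p) {q : ℕ → ℤ} (hq0 : q 0 = 0)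
    (hrec : ∀ t, q (t + 1) = if q t < d then q t + p - d else q t - d) (t : ℕ) :
    0 ≤ q t ∧ q t < p := by
  induction t with
  | zero => omega
  | succ t ih =>
    rw [hrec]
    split_ifs <;> omega

theorem greedyStock_modEq {p d : ℕ} {q : ℕ → ℤ}
    (hrec : ∀ t, q (t + 1) = if q t < d then q t + p - d else q t - d) (t n : ℕ) :
    q (t + n) ≡ q t - n * d [ZMOD p] := by
  induction n with
  | zero => simp
  | succ n ih =>
    have step : q (t + n + 1) ≡ q (t + n) - d [ZMOD p] := by
      rw [hrec]
      split_ifs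
      · rw [add_sub_right_comm]
        exact Int.add_modEq_right
      · rfl
    rw [← add_assoc, Nat.cast_succ, add_one_mul, ← sub_sub]
    exact step.trans (ih.sub_right (d : ℤ))

/-- Single-product Fixed-case lot-sizing: the greedy schedule is a feasible cyclic
schedule of length `p / gcd p d`. -/
theorem stmt_3 (p d : ℕ) (hd : 0 < d) (hdp : d ≤ p)
    (q : ℕ → ℤ) (hq0 : q 0 = 0)
    (hrec : ∀ t, q (t + 1) = if q t < d then q t + p - d else q t - d) :
    (∀ t, 0 ≤ q t ∧ q t < p) ∧
    (∀ t, q (t + p / Nat.gcd p d) = q t) := by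
  have bounds := greedyStock_bounds hd hdp hq0 hrec
  refine ⟨bounds, fun t => ?_⟩
  have hdvd : (p : ℤ) ∣ ((p / Nat.gcd p d : ℕ) : ℤ) * d := by
    norm_cast
    rw [Nat.div_mul_right_comm (Nat.gcd_dvd_left p d), Nat.mul_div_assoc _ (Nat.gcd_dvd_right p d)]
    exact dvd_mul_right _ _
  have hmod : q (t + p / Nat.gcd p d) ≡ q t [ZMOD p] := by
    simpa using (greedyStock_modEq hrec t (p / Nat.gcd p d)).trans
      ((Int.modEq_zero_iff_dvd.mpr hdvd).sub_left (q t))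
  rwa [Int.ModEq, Int.emod_eq_of_lt (bounds _).1 (bounds _).2,
    Int.emod_eq_of_lt (bounds _).1 (bounds _).2] at hmod
end

section
/- In the single-product Fixed-case lot-sizing model, over one period the greedy schedule's stock levels are exactly the multiples of gcd(p,d) smaller than p: with l* = p / gcd(p,d), the set { q t : t < l* } equals { m ∈ ℕ : m < p and gcd(p,d) ∣ m } (and in particular these l* values are pairwise distinct). -/
/-- The greedy stock level at time `t` is the residue of `-t * d` modulo `p`. -/
theorem greedy_stock_eq_emod (p d : ℕ) (hd : 0 < d) (hdp : d ≤ p)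
    (q : ℕ → ℤ) (hq0 : q 0 = 0)
    (hrec : ∀ t, q (t + 1) = if q t < d then q t + p - d else q t - d) (t : ℕ) :
    q t = (-(t * d : ℤ)) % p := by
  have h : 0 ≤ q t ∧ q t < p ∧ q t ≡ -(t * d : ℤ) [ZMOD p] := by
    induction t with
    | zero => simp [hq0]; omega
    | succ t ih =>
      obtain ⟨h0, h1, h2⟩ := ih
      rw [hrec]
      have h3 : q t - d ≡ -((t + 1 : ℕ) * d : ℤ) [ZMOD p] := by
        convert h2.sub_right (d : ℤ) using 1
        push_cast
        ring
      split_ifs with h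
      · refine ⟨by omega, by omega, ?_⟩
        rw [add_sub_right_comm]
        exact Int.add_modEq_right.trans h3
      · exact ⟨by omega, by omega, h3⟩
  rw [← h.2.2, Int.emod_eq_of_lt h.1 h.2.1]

/-- Single-product Fixed-case lot-sizing: over one period, the greedy schedule's stock
levels are exactly the multiples of `gcd p d` smaller than `p`, and they are pairwise
distinct. -/
theorem stmt_4 (p d : ℕ) (hd : 0 < d) (hdp : d ≤ p)
    (q : ℕ → ℤ) (hq0 : q 0 = 0)
    (hrec : ∀ t, q (t + 1) = if q t < d then q t + p - d else q t - d) :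
    { z : ℤ | ∃ t < p / Nat.gcd p d, q t = z }
      = { z : ℤ | 0 ≤ z ∧ z < p ∧ (Nat.gcd p d : ℤ) ∣ z } ∧
    Set.InjOn q (Set.Iio (p / Nat.gcd p d)) := by
  have hq := greedy_stock_eq_emod p d hd hdp q hq0 hrec
  have hp : 0 < p := hd.trans_le hdp
  have hpz : (0 : ℤ) < p := by exact_mod_cast hp
  have hgp : (Nat.gcd p d : ℤ) ∣ p := by exact_mod_cast Nat.gcd_dvd_left p d
  have hgd : (Nat.gcd p d : ℤ) ∣ d := by exact_mod_cast Nat.gcd_dvd_right p d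
  have hl : 0 < p / Nat.gcd p d := Nat.div_gcd_pos_of_pos_left d hp
  constructor
  · ext z
    constructor
    · rintro ⟨t, -, rfl⟩
      rw [hq]
      exact ⟨Int.emod_nonneg _ hpz.ne', Int.emod_lt_of_pos _ hpz,
        (EuclideanDomain.dvd_mod_iff hgp).2 (hgd.mul_left _).neg_right⟩
    · rintro ⟨h0, h1, k, rfl⟩
      set l := p / Nat.gcd p d
      have hlz : (0 : ℤ) < l := by exact_mod_cast hl
      set y := Nat.gcdB p d
      obtain ⟨e, he⟩ := hgd
      have hlg : (p : ℤ) = Nat.gcd p d * l := by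
        exact_mod_cast (Nat.mul_div_cancel' (Nat.gcd_dvd_left p d)).symm
      have hb := Nat.gcd_eq_gcd_ab p d
      have hs := Int.emod_nonneg (-(y * k)) hlz.ne'
      refine ⟨((-(y * k)) % l).toNat, ?_, ?_⟩
      · have := Int.emod_lt_of_pos (-(y * k)) hlz
        omega
      · rw [hq, Int.toNat_of_nonneg hs, ← Int.emod_eq_of_lt h0 h1]
        apply Int.ModEq.symm
        rw [Int.modEq_iff_dvd]
        have hm := Int.emod_add_mul_ediv (-(y * k)) l
        refine ⟨e * (-(y * k) / l) - Nat.gcdA p d * k, ?_⟩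
        linear_combination (-(d : ℤ)) * hm - k * hb - (e * (-(y * k) / l)) * hlg
          + (l * (-(y * k) / l)) * he
  · intro s hs t ht hst
    rw [hq, hq] at hst
    have h : (s * d : ℤ) ≡ t * d [ZMOD p] := by
      simpa using Int.ModEq.neg hst
    have h' : s * d ≡ t * d [MOD p] := by
      rw [← Int.natCast_modEq_iff]
      exact_mod_cast h
    exact (Nat.ModEq.cancel_right_div_gcd hp h').eq_of_lt_of_lt hs ht
end

section
/- In the single-product Fixed-case lot-sizing model, the total holding cost of one period of the greedy schedule equals (h·p/2)·(p/gcd(p,d) − 1): with l* = p / gcd(p,d), one has 2 · ∑_{t=0}^{l*−1} q t = p · (l* − 1); consequently the greedy schedule's average holding cost per time unit equals (h/2)·(p − gcd(p,d)) for any holding cost h. -/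
/-- The greedy stock stays in `[0, p)` and is congruent to `-d * t` modulo `p`. -/
theorem greedy_stock_bounds_and_dvd {p d : ℕ} (hd : 0 < d) (hdp : d ≤ p)
    {q : ℕ → ℤ} (hq0 : q 0 = 0)
    (hrec : ∀ t, q (t + 1) = if q t < d then q t + p - d else q t - d) (t : ℕ) :
    0 ≤ q t ∧ q t < p ∧ (p : ℤ) ∣ q t + d * t := by
  induction t with
  | zero => simp [hq0]; omega
  | succ t ih =>
    obtain ⟨h0, h1, k, hk⟩ := ih
    rw [hrec t]
    split_ifs with hlt
    · refine ⟨by omega, by omega, k + 1, ?_⟩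
      push_cast
      linear_combination hk
    · refine ⟨by omega, by omega, k, ?_⟩
      push_cast
      linear_combination hk

/-- Inside one period the greedy stock is antisymmetric about its mean `p / 2`. -/
theorem greedy_stock_add_reflect {p d : ℕ} (hd : 0 < d) (hdp : d ≤ p)
    {q : ℕ → ℤ} (hq0 : q 0 = 0)
    (hrec : ∀ t, q (t + 1) = if q t < d then q t + p - d else q t - d)
    {s t : ℕ} (hs : 0 < s) (ht : 0 < t) (hst : s + t = p / Nat.gcd p d) :
    q s + q t = p := by
  have hg : 0 < Nat.gcd p d := Nat.gcd_pos_of_pos_right p hd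
  obtain ⟨hs0, hs1, hs2⟩ := greedy_stock_bounds_and_dvd hd hdp hq0 hrec s
  obtain ⟨ht0, ht1, ht2⟩ := greedy_stock_bounds_and_dvd hd hdp hq0 hrec t
  have hpos : q s ≠ 0 := by
    intro h
    rw [h, zero_add] at hs2
    have hdvd : p ∣ d * s := by exact_mod_cast hs2
    have hls : p / Nat.gcd p d ∣ s := by
      refine (Nat.coprime_div_gcd_div_gcd hg).dvd_of_dvd_mul_left ?_
      rw [← Nat.mul_dvd_mul_iff_left hg, ← mul_assoc,
        Nat.mul_div_cancel' (Nat.gcd_dvd_left p d),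
        Nat.mul_div_cancel' (Nat.gcd_dvd_right p d)]
      exact hdvd
    have := Nat.le_of_dvd hs hls
    omega
  have hperiod : (p : ℤ) ∣ d * (s + t) := by
    have : p ∣ d * (s + t) := by
      rw [hst, ← Nat.mul_div_assoc d (Nat.gcd_dvd_left p d), mul_comm,
        Nat.mul_div_assoc p (Nat.gcd_dvd_right p d)]
      exact dvd_mul_right _ _
    exact_mod_cast this
  have hsum : (p : ℤ) ∣ q s + q t - p := by
    obtain ⟨a, ha⟩ := hs2
    obtain ⟨b, hb⟩ := ht2
    obtain ⟨c, hc⟩ := hperiod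
    exact ⟨a + b - c - 1, by linear_combination ha + hb - hc⟩
  have := Int.eq_zero_of_abs_lt_dvd hsum (by rw [abs_lt]; constructor <;> omega)
  omega

/-- Single-product Fixed-case lot-sizing: the total stock over one period of the greedy
schedule satisfies `2 * ∑ q t = p * (l* - 1)` with `l* = p / gcd p d`; consequently the
average holding cost per time unit equals `h/2 * (p - gcd p d)` for any holding cost
`h > 0`. -/
theorem stmt_5 (p d : ℕ) (hd : 0 < d) (hdp : d ≤ p)
    (q : ℕ → ℤ) (hq0 : q 0 = 0)
    (hrec : ∀ t, q (t + 1) = if q t < d then q t + p - d else q t - d) :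
    2 * ∑ t ∈ Finset.range (p / Nat.gcd p d), q t
        = (p : ℤ) * (((p / Nat.gcd p d : ℕ) : ℤ) - 1) ∧
    ∀ h : ℝ, 0 < h →
      (h * ∑ t ∈ Finset.range (p / Nat.gcd p d), (q t : ℝ)) / ((p / Nat.gcd p d : ℕ) : ℝ)
        = h / 2 * ((p : ℝ) - (Nat.gcd p d : ℝ)) := by
  have hg : 0 < Nat.gcd p d := Nat.gcd_pos_of_pos_right p hd
  have hl : 0 < p / Nat.gcd p d := Nat.div_pos (Nat.gcd_le_left d (by omega)) hg
  have htotal : 2 * ∑ t ∈ Finset.range (p / Nat.gcd p d), q t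
      = (p : ℤ) * (((p / Nat.gcd p d : ℕ) : ℤ) - 1) := by
    obtain ⟨m, hm⟩ : ∃ m, p / Nat.gcd p d = m + 1 := ⟨_, (Nat.succ_pred hl.ne').symm⟩
    rw [hm, Finset.sum_range_succ', hq0, add_zero, two_mul]
    nth_rewrite 2 [← Finset.sum_range_reflect]
    rw [← Finset.sum_add_distrib, Finset.sum_congr rfl (g := fun _ => (p : ℤ))]
    · simp [mul_comm]
    · intro i hi
      have := Finset.mem_range.mp hi
      exact greedy_stock_add_reflect hd hdp hq0 hrec (by omega) (by omega) (by omega)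
  refine ⟨htotal, fun h _ => ?_⟩
  have hmul : ((Nat.gcd p d : ℕ) : ℝ) * ((p / Nat.gcd p d : ℕ) : ℝ) = p := by
    exact_mod_cast Nat.mul_div_cancel' (Nat.gcd_dvd_left p d)
  have htotal' : 2 * ∑ t ∈ Finset.range (p / Nat.gcd p d), (q t : ℝ)
      = (p : ℝ) * (((p / Nat.gcd p d : ℕ) : ℝ) - 1) := by
    exact_mod_cast htotal
  rw [div_eq_iff (by exact_mod_cast hl.ne')]
  linear_combination h / 2 * htotal' + h / 2 * hmul
end

section
/- In the single-product Fixed-case lot-sizing model, the infimum (in fact minimum) of the average holding cost per time unit over all feasible cyclic schedules (over all initial stocks q0 ≥ 0, production patterns x, and positive lengths l) equals (h/2)·(p − gcd(p,d)), and it is attained by a schedule of length p / gcd(p,d). -/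
theorem ZMod.sum_range_natCast {M : Type*} [AddCommMonoid M] (n : ℕ) [NeZero n]
    (F : ZMod n → M) : ∑ t ∈ Finset.range n, F t = ∑ z, F z :=
  Finset.sum_nbij' (fun t => (t : ZMod n)) ZMod.val (by simp)
    (fun z _ => Finset.mem_range.2 (ZMod.val_lt z))
    (fun t ht => ZMod.val_natCast_of_lt (Finset.mem_range.1 ht)) (by simp) (by simp)

theorem ZMod.sum_range_mul_natCast {M : Type*} [AddCommMonoid M] (n m : ℕ) [NeZero n]
    (F : ZMod n → M) : ∑ t ∈ Finset.range (n * m), F t = m • ∑ z, F z := by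
  induction m with
  | zero => simp
  | succ m ih =>
    rw [mul_add_one, Finset.sum_range_add, ih, succ_nsmul, ← ZMod.sum_range_natCast n F]
    simp

theorem ZMod.two_mul_sum_val (n : ℕ) [NeZero n] :
    2 * ∑ z : ZMod n, (z.val : ℤ) = n * (n - 1) := by
  rw [← ZMod.sum_range_natCast n (fun z => (z.val : ℤ)),
    Finset.sum_congr rfl fun t ht => by rw [ZMod.val_natCast_of_lt (Finset.mem_range.1 ht)]]
  have h := Finset.sum_range_id_mul_two n
  have hn : 1 ≤ n := NeZero.one_le
  zify [hn] at h
  linarith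

/-- Over `m` periods, the residues of an arithmetic progression whose step is coprime to the
modulus run `m` times through all residues. -/
theorem ZMod.two_mul_sum_val_sub_mul (n m D : ℕ) [NeZero n] (hD : D.Coprime n) (c : ZMod n) :
    2 * ∑ t ∈ Finset.range (n * m), ((c - t * D : ZMod n).val : ℤ) = m * (n * (n - 1)) := by
  have hu : IsUnit (D : ZMod n) := (ZMod.isUnit_iff_coprime D n).2 hD
  have hinj : Function.Injective fun z : ZMod n => c - z * D := fun a b hab =>
    hu.mul_right_cancel (sub_right_injective hab)
  rw [ZMod.sum_range_mul_natCast n m (fun z => ((c - z * D : ZMod n).val : ℤ)),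
    (Finite.injective_iff_bijective.1 hinj).sum_comp (fun z : ZMod n => (z.val : ℤ)),
    ← ZMod.two_mul_sum_val n, nsmul_eq_mul]
  ring

/-- In units of `g`, the stock of a schedule is determined modulo `P`. -/
theorem intCast_stock_ediv (g P D : ℕ) (hg : 0 < g) (x : ℕ → Bool) (q : ℕ → ℤ)
    (hq : ∀ t, q (t + 1) = q t + (if x t then ((g * P : ℕ) : ℤ) else 0) - (g * D : ℕ)) (t : ℕ) :
    ((q t / g : ℤ) : ZMod P) = (q 0 / g : ℤ) - t * D := by
  have hg' : (g : ℤ) ≠ 0 := by positivity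
  induction t with
  | zero => simp
  | succ t ih =>
    have key : q (t + 1) / g = q t / g + ((if x t then (P : ℤ) else 0) - D) := by
      rw [← Int.add_mul_ediv_left _ _ hg', hq]
      congr 1
      split_ifs <;> push_cast <;> ring
    rw [key]
    push_cast
    rw [ih]
    split_ifs <;> simp <;> ring

theorem stock_sum_lower_bound (g P D l : ℕ) (hg : 0 < g) (hP : 0 < P) (hD : D.Coprime P)
    (x : ℕ → Bool) (q : ℕ → ℤ)
    (hq : ∀ t, q (t + 1) = q t + (if x t then ((g * P : ℕ) : ℤ) else 0) - (g * D : ℕ))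
    (hpos : ∀ t ≤ l, 0 ≤ q t) (hcyc : q l = q 0) :
    (l : ℤ) * (g * P - g) ≤ 2 * ∑ t ∈ Finset.range l, q t := by
  have : NeZero P := ⟨hP.ne'⟩
  have hstock := intCast_stock_ediv g P D hg x q hq
  obtain ⟨m, rfl⟩ : P ∣ l := by
    have hl := hstock l
    rw [hcyc, eq_comm, sub_eq_self] at hl
    have hu : IsUnit (D : ZMod P) := (ZMod.isUnit_iff_coprime D P).2 hD
    exact (ZMod.natCast_eq_zero_iff l P).1 (hu.mul_left_eq_zero.1 hl)
  have hle : ∀ t ∈ Finset.range (P * m),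
      (g : ℤ) * ((((q 0 / g : ℤ) : ZMod P) - t * D).val : ℤ) ≤ q t := fun t ht => by
    rw [← hstock, ZMod.val_intCast]
    have h0 := hpos t (Finset.mem_range.1 ht).le
    calc (g : ℤ) * (q t / g % P) ≤ g * (q t / g) := by
          gcongr
          have hdiv : 0 ≤ q t / (g : ℤ) := by positivity
          have hquot : 0 ≤ (P : ℤ) * (q t / g / P) := by positivity
          linarith [Int.emod_add_mul_ediv (q t / g) P]
      _ ≤ q t := Int.mul_ediv_self_le (by positivity)
  have hsum := Finset.sum_le_sum hle
  rw [← Finset.mul_sum] at hsum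
  have hval := ZMod.two_mul_sum_val_sub_mul P m D hD ((q 0 / g : ℤ) : ZMod P)
  calc ((P * m : ℕ) : ℤ) * (g * P - g) = g * (m * (P * (P - 1))) := by push_cast; ring
    _ = 2 * (g * ∑ t ∈ Finset.range (P * m), ((((q 0 / g : ℤ) : ZMod P) - t * D).val : ℤ)) := by
      rw [← hval]; ring
    _ ≤ _ := by gcongr

/-- Producing exactly when the stock does not cover the demand, starting from an empty stock,
keeps the stock at the residue of `-t * d` modulo `p`. -/
theorem neg_mul_emod_succ (p d : ℕ) (hd : 0 < d) (hdp : d ≤ p) (t : ℕ) :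
    -(((t + 1 : ℕ) : ℤ) * d) % p = -((t : ℤ) * d) % p +
      (if decide (-((t : ℤ) * d) % p < d) then (p : ℤ) else 0) - d := by
  have hp : (0 : ℤ) < p := by exact_mod_cast hd.trans_le hdp
  have h0 := Int.emod_nonneg (-((t : ℤ) * d)) hp.ne'
  have h1 := Int.emod_lt_of_pos (-((t : ℤ) * d)) hp
  have hstep : -(((t + 1 : ℕ) : ℤ) * d) % p = (-((t : ℤ) * d) % p - d) % p := by
    rw [Int.emod_sub_emod]
    congr 1
    push_cast
    ring
  rw [hstep]
  simp only [decide_eq_true_eq]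
  split_ifs with hlt
  · rw [← Int.add_emod_right, Int.emod_eq_of_lt] <;> omega
  · rw [Int.emod_eq_of_lt] <;> omega

theorem two_mul_sum_neg_mul_emod (g P D : ℕ) (hg : 0 < g) (hP : 0 < P) (hD : D.Coprime P) :
    2 * ∑ t ∈ Finset.range P, -((t : ℤ) * (g * D : ℕ)) % (g * P : ℕ) = P * (g * P - g) := by
  have : NeZero P := ⟨hP.ne'⟩
  have hterm : ∀ t : ℕ, -((t : ℤ) * (g * D : ℕ)) % (g * P : ℕ)
      = g * ((0 - t * D : ZMod P).val : ℤ) := fun t => by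
    have hcast : (0 - t * D : ZMod P) = ((-(t * D) : ℤ) : ZMod P) := by simp
    rw [hcast, ZMod.val_intCast, ← Int.mul_emod_mul_of_pos _ _ (by positivity : (0 : ℤ) < g)]
    push_cast
    ring_nf
  have hval := ZMod.two_mul_sum_val_sub_mul P 1 D hD 0
  rw [mul_one, Nat.cast_one, one_mul] at hval
  simp only [hterm]
  rw [← Finset.mul_sum, mul_left_comm, hval]
  ring


/-- Single-product Fixed-case lot-sizing: the minimum of the average holding cost per
time unit over all feasible cyclic schedules equals `h/2 * (p - gcd p d)`, and it is
attained by a schedule of length `p / gcd p d`. -/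
theorem stmt_7 (p d : ℕ) (hd : 0 < d) (hdp : d ≤ p) (h : ℝ) (hh : 0 < h) :
    IsLeast { c : ℝ | ∃ (l : ℕ) (q0 : ℤ) (x : ℕ → Bool) (q : ℕ → ℤ),
        0 < l ∧ 0 ≤ q0 ∧ q 0 = q0 ∧
        (∀ t, q (t + 1) = q t + (if x t then (p : ℤ) else 0) - d) ∧
        (∀ t ≤ l, 0 ≤ q t) ∧ q l = q 0 ∧
        c = (h * ∑ t ∈ Finset.range l, (q t : ℝ)) / (l : ℝ) }
      (h / 2 * ((p : ℝ) - (Nat.gcd p d : ℝ))) ∧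
    ∃ (q0 : ℤ) (x : ℕ → Bool) (q : ℕ → ℤ),
      0 ≤ q0 ∧ q 0 = q0 ∧
      (∀ t, q (t + 1) = q t + (if x t then (p : ℤ) else 0) - d) ∧
      (∀ t ≤ p / Nat.gcd p d, 0 ≤ q t) ∧ q (p / Nat.gcd p d) = q 0 ∧
      (h * ∑ t ∈ Finset.range (p / Nat.gcd p d), (q t : ℝ)) / ((p / Nat.gcd p d : ℕ) : ℝ)
        = h / 2 * ((p : ℝ) - (Nat.gcd p d : ℝ)) := by
  obtain ⟨g, P, D, hg, hP, hD, rfl, rfl, hgcd⟩ : ∃ g P D : ℕ, 0 < g ∧ 0 < P ∧ D.Coprime P ∧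
      p = g * P ∧ d = g * D ∧ p.gcd d = g := by
    have hg : 0 < p.gcd d := Nat.gcd_pos_of_pos_right p hd
    exact ⟨p.gcd d, p / p.gcd d, d / p.gcd d, hg,
      Nat.div_pos (Nat.gcd_le_left d (hd.trans_le hdp)) hg,
      (Nat.coprime_div_gcd_div_gcd hg).symm, (Nat.mul_div_cancel' (Nat.gcd_dvd_left p d)).symm,
      (Nat.mul_div_cancel' (Nat.gcd_dvd_right p d)).symm, rfl⟩
  rw [hgcd, Nat.mul_div_cancel_left P hg]
  have hopt : ∃ (q0 : ℤ) (x : ℕ → Bool) (q : ℕ → ℤ),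
      0 ≤ q0 ∧ q 0 = q0 ∧
      (∀ t, q (t + 1) = q t + (if x t then ((g * P : ℕ) : ℤ) else 0) - (g * D : ℕ)) ∧
      (∀ t ≤ P, 0 ≤ q t) ∧ q P = q 0 ∧
      (h * ∑ t ∈ Finset.range P, (q t : ℝ)) / (P : ℝ)
        = h / 2 * (((g * P : ℕ) : ℝ) - (g : ℝ)) := by
    refine ⟨0, fun t => decide (-((t : ℤ) * (g * D : ℕ)) % (g * P : ℕ) < (g * D : ℕ)),
      fun t => -((t : ℤ) * (g * D : ℕ)) % (g * P : ℕ), le_rfl, by simp,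
      neg_mul_emod_succ _ _ hd hdp, fun t _ => Int.emod_nonneg _ (by positivity), ?_, ?_⟩
    · have hdvd : ((g * P : ℕ) : ℤ) ∣ -((P : ℤ) * (g * D : ℕ)) :=
        ⟨-D, by push_cast; ring⟩
      simpa using Int.emod_eq_zero_of_dvd hdvd
    · have hsum := congrArg (Int.cast : ℤ → ℝ) (two_mul_sum_neg_mul_emod g P D hg hP hD)
      rw [Int.cast_mul, Int.cast_sum] at hsum
      have hP' : (P : ℝ) ≠ 0 := by positivity
      rw [div_eq_iff hP']
      push_cast at hsum ⊢
      linear_combination h / 2 * hsum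
  refine ⟨⟨?_, ?_⟩, hopt⟩
  · obtain ⟨q0, x, q, h0, hq0, hq, hpos, hcyc, hc⟩ := hopt
    exact ⟨P, q0, x, q, hP, h0, hq0, hq, hpos, hcyc, hc.symm⟩
  · rintro _ ⟨l, q0, x, q, hl, -, -, hq, hpos, hcyc, rfl⟩
    have hsum : (l : ℝ) * (g * P - g) ≤ 2 * ∑ t ∈ Finset.range l, (q t : ℝ) := by
      exact_mod_cast stock_sum_lower_bound g P D l hg hP hD x q hq hpos hcyc
    rw [le_div_iff₀ (by positivity)]
    push_cast
    linear_combination h / 2 * hsum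
end

section
/- In the single-product Fixed-case lot-sizing model, an optimal schedule produces at time t if and only if the current stock is below the demand: if a feasible cyclic schedule of length l with initial stock q 0 = 0 attains the minimal average holding cost, i.e. 2 · ∑_{t=0}^{l−1} q t = l · (p − gcd(p,d)), then for every t < l one has x t = true if and only if q t < d. -/
/-- The stock at time `t` is congruent to `-t * d` modulo `p` when the initial stock is zero. -/
theorem dvd_stock_add_mul {p d : ℕ} {x : ℕ → Bool} {q : ℕ → ℤ} (hq0 : q 0 = 0)
    (hrec : ∀ t, q (t + 1) = q t + (if x t then (p : ℤ) else 0) - d) (t : ℕ) :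
    (p : ℤ) ∣ q t + t * d := by
  induction t with
  | zero => simp [hq0]
  | succ t ih =>
    have h : q (t + 1) + ((t + 1 : ℕ) : ℤ) * d
        = (q t + t * d) + (if x t then (p : ℤ) else 0) := by
      rw [hrec]; push_cast; ring
    rw [h]
    refine dvd_add ih ?_
    split_ifs <;> simp

/-- If `p ∣ l * d`, at most `l * gcd p d / p` of the times `t < l` satisfy `p ∣ t * d`. -/
theorem mul_card_filter_dvd_mul_le {p d l : ℕ} (hp : 0 < p) (hl : p ∣ l * d) :
    p * ((Finset.range l).filter (fun t => p ∣ t * d)).card ≤ l * Nat.gcd p d := by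
  obtain ⟨g, m, e, hg, hcop, hm, he⟩ := Nat.exists_coprime' (Nat.gcd_pos_of_pos_left d hp)
  have key (t : ℕ) : p ∣ t * d ↔ m ∣ t := by
    rw [hm, he, ← mul_assoc, Nat.mul_dvd_mul_iff_right hg]
    exact hcop.dvd_mul_right
  have hgcd : Nat.gcd p d = g := by
    rw [hm, he, Nat.gcd_mul_right, hcop, one_mul]
  obtain ⟨k, rfl⟩ := (key l).1 hl
  have hsub : (Finset.range (m * k)).filter (fun t => p ∣ t * d)
      ⊆ (Finset.range k).image (m * ·) := by
    intro t ht
    rw [Finset.mem_filter, Finset.mem_range, key] at ht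
    obtain ⟨hlt, j, rfl⟩ := ht
    exact Finset.mem_image.2 ⟨j, Finset.mem_range.2 (lt_of_mul_lt_mul_left' hlt), rfl⟩
  have hcard := (Finset.card_le_card hsub).trans Finset.card_image_le
  rw [Finset.card_range] at hcard
  calc _ ≤ p * k := Nat.mul_le_mul_left p hcard
    _ = m * k * Nat.gcd p d := by rw [hgcd, hm]; ring

/-- Pairing residues of opposite times gives a lower bound on their sum over a cycle. -/
theorem mul_sub_gcd_le_two_mul_sum_emod {p d l : ℕ} (hp : 0 < p) {q : ℕ → ℤ}
    (hq : ∀ t : ℕ, (p : ℤ) ∣ q t + t * d) (hl : q l = q 0) :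
    (l : ℤ) * ((p : ℤ) - (Nat.gcd p d : ℤ)) ≤ 2 * ∑ t ∈ Finset.range l, q t % p := by
  have hp' : (0 : ℤ) < p := by exact_mod_cast hp
  have hq0 : (p : ℤ) ∣ q 0 := by simpa using hq 0
  have hld : p ∣ l * d := by
    have h := hq l
    rw [hl, dvd_add_right hq0] at h
    exact_mod_cast h
  have hrefl : ∑ t ∈ Finset.range l, q (l - t) % p = ∑ t ∈ Finset.range l, q t % p := by
    have h1 := Finset.sum_range_reflect (fun t => q t % p) (l + 1)
    rw [Finset.sum_range_succ, Finset.sum_range_succ] at h1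
    simpa [hl] using h1
  have hpair : ∀ t ∈ Finset.range l,
      (p : ℤ) - (if p ∣ t * d then (p : ℤ) else 0) ≤ q t % p + q (l - t) % p := by
    intro t ht
    have h1 := Int.emod_nonneg (q t) hp'.ne'
    have h2 := Int.emod_nonneg (q (l - t)) hp'.ne'
    split_ifs with h
    · linarith
    have hdvd : (p : ℤ) ∣ q t % p + q (l - t) % p := by
      have hle : t ≤ l := (Finset.mem_range.1 ht).le
      have h3 : (p : ℤ) ∣ (l : ℤ) * d := by exact_mod_cast hld
      have h4 := dvd_sub (dvd_add (hq t) (hq (l - t))) h3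
      rw [Nat.cast_sub hle] at h4
      have h5 : (p : ℤ) ∣ q t + q (l - t) := by
        have h6 : q t + q (l - t)
            = q t + t * d + (q (l - t) + ((l : ℤ) - t) * d) - l * d := by ring
        rwa [h6]
      exact Int.dvd_of_emod_eq_zero (by simpa using Int.emod_eq_zero_of_dvd h5)
    have hne : q t % p ≠ 0 := by
      intro h0
      have h3 := (dvd_add_right (Int.dvd_of_emod_eq_zero h0)).1 (hq t)
      exact h (by exact_mod_cast h3)
    have := Int.le_of_dvd (by omega) hdvd
    linarith
  have hsum := Finset.sum_le_sum hpair
  rw [Finset.sum_add_distrib, hrefl, Finset.sum_sub_distrib, ← Finset.sum_filter] at hsum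
  simp only [Finset.sum_const, Finset.card_range, nsmul_eq_mul] at hsum
  have hcount : (p : ℤ) * (((Finset.range l).filter (fun t => p ∣ t * d)).card : ℤ)
      ≤ l * (Nat.gcd p d : ℤ) := by
    exact_mod_cast mul_card_filter_dvd_mul_le hp hld
  linarith

/-- Single-product Fixed-case lot-sizing: a feasible cyclic schedule with zero initial
stock attaining the minimal average holding cost produces at time `t` if and only if the
current stock is below the demand. -/
theorem stmt_8 (p d : ℕ) (hd : 0 < d) (hdp : d ≤ p)
    (x : ℕ → Bool) (q : ℕ → ℤ) (hq0 : q 0 = 0)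
    (hrec : ∀ t, q (t + 1) = q t + (if x t then (p : ℤ) else 0) - d)
    (l : ℕ) (hl : 0 < l)
    (hfeas : ∀ t ≤ l, 0 ≤ q t) (hcyc : q l = q 0)
    (hopt : 2 * ∑ t ∈ Finset.range l, q t = (l : ℤ) * ((p : ℤ) - (Nat.gcd p d : ℤ))) :
    ∀ t < l, (x t = true ↔ q t < d) := by
  have hp : 0 < p := hd.trans_le hdp
  have hp' : (0 : ℤ) < p := by exact_mod_cast hp
  have hbound := mul_sub_gcd_le_two_mul_sum_emod hp (dvd_stock_add_mul hq0 hrec) hcyc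
  have hle : ∀ t ∈ Finset.range l, q t % p ≤ q t := by
    intro t ht
    have h1 := Int.mul_ediv_add_emod (q t) p
    have h2 := mul_nonneg hp'.le
      (Int.ediv_nonneg (hfeas t (Finset.mem_range.1 ht).le) hp'.le)
    linarith
  have heq : ∑ t ∈ Finset.range l, q t % p = ∑ t ∈ Finset.range l, q t :=
    le_antisymm (Finset.sum_le_sum hle) (by linarith)
  have hlt : ∀ t ≤ l, q t < p := by
    intro t ht
    rcases ht.lt_or_eq with ht | rfl
    · rw [← (Finset.sum_eq_sum_iff_of_le hle).1 heq t (Finset.mem_range.2 ht)]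
      exact Int.emod_lt_of_pos _ hp'
    · rwa [hcyc, hq0]
  intro t ht
  have h1 := hrec t
  have h2 := hfeas (t + 1) ht
  have h3 := hlt (t + 1) ht
  cases hx : x t <;> simp [hx] at h1 ⊢ <;> linarith
end

section
/- In the single-product Fixed-case lot-sizing model with initial stock q0 satisfying 0 ≤ q0 < p, let G = gcd(p,d). The minimum total holding cost over all feasible cyclic schedules of length l* = p/G with initial stock q0 equals (h·p/2)·(p/G − 1) + h·(p/G)·(q0 mod G); in particular, when G divides q0 this minimum is (h·p/2)·(p/G − 1). -/
/-- The residues of an arithmetic progression whose step is coprime to the modulus `l`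
run over `0, …, l - 1` in one period. -/
theorem sum_emod_sub_mul_of_coprime {l k : ℕ} (hl : 0 < l) (hk : Nat.Coprime l k) (a : ℤ) :
    ∑ t ∈ Finset.range l, (a - t * k) % (l : ℤ) = ∑ i ∈ Finset.range l, (i : ℤ) := by
  have hl' : (0 : ℤ) < l := by exact_mod_cast hl
  have hcast (t : ℕ) : ((((a - t * k) % (l : ℤ)).toNat : ℕ) : ℤ) = (a - t * k) % (l : ℤ) :=
    Int.toNat_of_nonneg (Int.emod_nonneg _ hl'.ne')
  have hinj : Set.InjOn (fun t : ℕ => ((a - t * k) % (l : ℤ)).toNat) (Finset.range l) := by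
    intro s hs t ht hst
    have hs' : s < l := by simpa using hs
    have ht' : t < l := by simpa using ht
    have hmod : (a - s * k) % (l : ℤ) = (a - t * k) % (l : ℤ) := by
      rw [← hcast s, ← hcast t]
      exact_mod_cast hst
    have hdvd : (l : ℤ) ∣ ((t : ℤ) - s) * k := by
      convert Int.ModEq.dvd hmod.symm using 1
      ring
    have hdvd' : (l : ℤ) ∣ (t : ℤ) - s :=
      (Nat.isCoprime_iff_coprime.mpr hk).dvd_of_dvd_mul_right hdvd
    have := Int.eq_zero_of_abs_lt_dvd hdvd' (by rw [abs_lt]; omega)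
    omega
  have himage : (Finset.range l).image (fun t : ℕ => ((a - t * k) % (l : ℤ)).toNat)
      = Finset.range l := by
    refine Finset.eq_of_subset_of_card_le (fun i hi => ?_) ?_
    · obtain ⟨t, -, rfl⟩ := Finset.mem_image.mp hi
      have := Int.emod_lt_of_pos (a - t * k) hl'
      have := hcast t
      exact Finset.mem_range.mpr (by omega)
    · rw [Finset.card_image_of_injOn hinj]
  conv_rhs => rw [← himage, Finset.sum_image hinj]
  exact Finset.sum_congr rfl fun t _ => (hcast t).symm

theorem Int.mul_add_emod_mul {g l b : ℤ} (hl : 0 < l) (hb : 0 ≤ b) (hbg : b < g) (m : ℤ) :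
    (g * m + b) % (g * l) = g * (m % l) + b := by
  have hm0 := Int.emod_nonneg m hl.ne'
  have hml := Int.emod_lt_of_pos m hl
  have hsplit : g * m + b = g * (m % l) + b + g * l * (m / l) := by
    linear_combination -g * Int.emod_add_mul_ediv m l
  rw [hsplit, Int.add_mul_emod_self_left]
  exact Int.emod_eq_of_lt (by nlinarith) (by nlinarith)

/-- The sum of the least residues mod `p` of `q0 - t * d` over one period `p / gcd p d`. -/
theorem sum_emod_sub_mul_period {p d : ℕ} (hp : 0 < p) (q0 : ℤ) :
    ((∑ t ∈ Finset.range (p / Nat.gcd p d), (q0 - t * d) % (p : ℤ) : ℤ) : ℝ)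
      = (p : ℝ) / 2 * (((p / Nat.gcd p d : ℕ) : ℝ) - 1)
        + ((p / Nat.gcd p d : ℕ) : ℝ) * ((q0 % (Nat.gcd p d : ℤ) : ℤ) : ℝ) := by
  have hg : 0 < Nat.gcd p d := Nat.gcd_pos_of_pos_left d hp
  have hcop : Nat.Coprime (p / Nat.gcd p d) (d / Nat.gcd p d) := Nat.coprime_div_gcd_div_gcd hg
  have hpg : Nat.gcd p d * (p / Nat.gcd p d) = p := Nat.mul_div_cancel' (Nat.gcd_dvd_left p d)
  have hdg : Nat.gcd p d * (d / Nat.gcd p d) = d := Nat.mul_div_cancel' (Nat.gcd_dvd_right p d)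
  have hl : 0 < p / Nat.gcd p d := Nat.div_pos (Nat.gcd_le_left d hp) hg
  generalize Nat.gcd p d = g at *
  generalize p / g = l at *
  generalize d / g = k at *
  subst hpg hdg
  have hg' : (0 : ℤ) < g := by exact_mod_cast hg
  have hterm (t : ℕ) : (q0 - t * ((g * k : ℕ) : ℤ)) % ((g * l : ℕ) : ℤ)
      = g * ((q0 / g - t * k) % (l : ℤ)) + q0 % g := by
    rw [← Int.mul_add_emod_mul (by exact_mod_cast hl) (Int.emod_nonneg q0 hg'.ne')
      (Int.emod_lt_of_pos q0 hg')]
    push_cast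
    congr 1
    linear_combination -Int.emod_add_mul_ediv q0 g
  have hgauss : (∑ i ∈ Finset.range l, (i : ℝ)) = l * (l - 1) / 2 := by
    clear * -
    induction l with
    | zero => simp
    | succ n ih => rw [Finset.sum_range_succ, ih]; push_cast; ring
  rw [Finset.sum_congr rfl fun t _ => hterm t, Finset.sum_add_distrib, ← Finset.mul_sum,
    sum_emod_sub_mul_of_coprime hl hcop]
  simp only [Finset.sum_const, Finset.card_range, nsmul_eq_mul]
  push_cast
  rw [hgauss]
  ring

/-- The stock is congruent to `q 0 - t * d` mod `p`. -/
theorem stock_emod {p d : ℤ} {x : ℕ → Bool} {q : ℕ → ℤ}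
    (hq : ∀ t, q (t + 1) = q t + (if x t then p else 0) - d) (t : ℕ) :
    q t % p = (q 0 - t * d) % p := by
  induction t with
  | zero => simp
  | succ n ih =>
    have hstep : q (n + 1) % p = (q n - d) % p := by
      rw [hq]
      split_ifs
      · rw [show q n + p - d = q n - d + p by ring, Int.add_emod_right]
      · rw [add_zero]
    rw [hstep, Int.sub_emod, ih, ← Int.sub_emod]
    push_cast
    congr 1
    ring

/-- Least residues evolve by producing exactly when the stock is below the demand. -/
theorem emod_sub_eq_ite {p d : ℤ} (hd : 0 ≤ d) (hdp : d ≤ p) (hp : 0 < p) (m : ℤ) :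
    (m - d) % p = m % p + (if m % p < d then p else 0) - d := by
  have h0 := Int.emod_nonneg m hp.ne'
  have h1 := Int.emod_lt_of_pos m hp
  rw [← Int.emod_sub_emod]
  split_ifs
  · rw [← Int.add_emod_right]
    rw [Int.emod_eq_of_lt (by omega) (by omega)]
    ring
  · rw [Int.emod_eq_of_lt (by omega) (by omega)]
    ring

/-- Single-product Fixed-case lot-sizing with initial stock `0 ≤ q0 < p`: the minimum
total holding cost over all feasible cyclic schedules of length `l* = p / gcd p d` with
initial stock `q0` equals `(h*p/2) * (p/G - 1) + h * (p/G) * (q0 mod G)` where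
`G = gcd p d`. -/
theorem stmt_9 (p d : ℕ) (hd : 0 < d) (hdp : d ≤ p) (h : ℝ) (hh : 0 < h)
    (q0 : ℤ) (hq00 : 0 ≤ q0) (hq0p : q0 < p) :
    IsLeast { c : ℝ | ∃ (x : ℕ → Bool) (q : ℕ → ℤ),
        q 0 = q0 ∧
        (∀ t, q (t + 1) = q t + (if x t then (p : ℤ) else 0) - d) ∧
        (∀ t ≤ p / Nat.gcd p d, 0 ≤ q t) ∧ q (p / Nat.gcd p d) = q 0 ∧
        c = h * ∑ t ∈ Finset.range (p / Nat.gcd p d), (q t : ℝ) }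
      (h * (p : ℝ) / 2 * (((p / Nat.gcd p d : ℕ) : ℝ) - 1)
        + h * ((p / Nat.gcd p d : ℕ) : ℝ) * ((q0 % (Nat.gcd p d : ℤ) : ℤ) : ℝ)) := by
  have hp : 0 < p := hd.trans_le hdp
  have hp' : (0 : ℤ) < p := by exact_mod_cast hp
  have hvalue : h * (p : ℝ) / 2 * (((p / Nat.gcd p d : ℕ) : ℝ) - 1)
        + h * ((p / Nat.gcd p d : ℕ) : ℝ) * ((q0 % (Nat.gcd p d : ℤ) : ℤ) : ℝ)
      = h * ∑ t ∈ Finset.range (p / Nat.gcd p d), (((q0 - t * d) % (p : ℤ) : ℤ) : ℝ) := by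
    rw [← Int.cast_sum, sum_emod_sub_mul_period hp]
    ring
  have hstart : q0 % (p : ℤ) = q0 := Int.emod_eq_of_lt hq00 hq0p
  rw [hvalue]
  constructor
  · refine ⟨fun t => decide ((q0 - t * d) % (p : ℤ) < d), fun t => (q0 - t * d) % (p : ℤ),
      by simpa using hstart, fun t => ?_, fun t _ => Int.emod_nonneg _ hp'.ne', ?_, rfl⟩
    · simp only [decide_eq_true_eq]
      rw [← emod_sub_eq_ite (by positivity) (by exact_mod_cast hdp) hp']
      push_cast
      congr 1
      ring
    · have hperiod : p / Nat.gcd p d * d = p * (d / Nat.gcd p d) := by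
        rw [Nat.div_mul_right_comm (Nat.gcd_dvd_left p d),
          Nat.mul_div_assoc _ (Nat.gcd_dvd_right p d)]
      have hperiod' : ((p / Nat.gcd p d : ℕ) : ℤ) * d = p * ((d / Nat.gcd p d : ℕ) : ℤ) := by
        exact_mod_cast hperiod
      simp only [hperiod', Int.sub_mul_emod_self_left, Nat.cast_zero, zero_mul, sub_zero]
  · rintro c ⟨x, q, hq0, hq, hpos, -, rfl⟩
    refine mul_le_mul_of_nonneg_left (Finset.sum_le_sum fun t ht => ?_) hh.le
    have hle : q t % (p : ℤ) ≤ q t := by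
      have hdiv := Int.ediv_nonneg (hpos t (Finset.mem_range.mp ht).le) hp'.le
      linarith [Int.emod_add_mul_ediv (q t) p, mul_nonneg hp'.le hdiv]
    rw [stock_emod hq, hq0] at hle
    exact_mod_cast hle
end

section
/- In the multi-product Fixed-case lot-sizing model, if ∑_{i=0}^{n−1} (d i : ℚ) / (p i : ℚ) ≤ 1 then a feasible cyclic schedule exists: there are an assignment a : ℕ → Option (Fin n) and initial stocks q i 0 ≥ 0 forming a feasible cyclic schedule of length C = ∏_{i} p i, in which each product i is produced during exactly C · d i / p i (an integer number of) consecutive time units. -/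
/-- Intervals of lengths `L i` laid end to end in the order of the indices do not overlap. -/
lemma sum_Iio_add_le_sum_Iio {ι : Type*} [LinearOrder ι] [LocallyFiniteOrderBot ι]
    (L : ι → ℕ) {i j : ι} (hij : i < j) :
    ∑ k ∈ Finset.Iio i, L k + L i ≤ ∑ k ∈ Finset.Iio j, L k := by
  rw [add_comm, ← Finset.sum_insert Finset.notMem_Iio_self]
  refine Finset.sum_le_sum_of_subset fun k hk => ?_
  simp only [Finset.mem_insert, Finset.mem_Iio] at hk ⊢
  rcases hk with rfl | hk
  · exact hij
  · exact hk.trans hij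

lemma sum_Iio_add_le_sum {ι : Type*} [Fintype ι] [LinearOrder ι] [LocallyFiniteOrderBot ι]
    (L : ι → ℕ) (i : ι) : ∑ k ∈ Finset.Iio i, L k + L i ≤ ∑ k, L k := by
  rw [add_comm, ← Finset.sum_insert Finset.notMem_Iio_self]
  exact Finset.sum_le_sum_of_subset (Finset.subset_univ _)

/-- Pairwise disjoint discrete intervals can be scheduled on a single machine. -/
lemma exists_option_eq_some_iff {ι : Type*} [LinearOrder ι] (s L : ι → ℕ)
    (h : ∀ i j, i < j → s i + L i ≤ s j) :
    ∃ a : ℕ → Option ι, ∀ i t, a t = some i ↔ s i ≤ t ∧ t < s i + L i := by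
  classical
  refine ⟨fun t => if ht : ∃ i, s i ≤ t ∧ t < s i + L i then some ht.choose else none,
    fun i t => ?_⟩
  by_cases ht : ∃ i, s i ≤ t ∧ t < s i + L i
  · simp only [dif_pos ht, Option.some.injEq]
    have hc := ht.choose_spec
    refine ⟨fun e => e ▸ hc, fun hi => ?_⟩
    rcases lt_trichotomy ht.choose i with hlt | heq | hlt
    · have := h _ _ hlt
      omega
    · exact heq
    · have := h _ _ hlt
      omega
  · simp only [dif_neg ht, reduceCtorEq, false_iff]
    exact fun hi => ht ⟨i, hi⟩

/-- Multi-product Fixed-case lot-sizing: if `∑ i, d i / p i ≤ 1` then a feasible cyclic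
schedule of length `C = ∏ i, p i` exists, in which each product `i` is produced during
exactly `C * d i / p i` consecutive time units. -/
theorem stmt_11 (n : ℕ) (hn : 1 ≤ n) (d p : Fin n → ℕ)
    (hd : ∀ i, 0 < d i) (hdp : ∀ i, d i ≤ p i)
    (hsum : ∑ i, (d i : ℚ) / (p i : ℚ) ≤ 1) :
    ∃ (a : ℕ → Option (Fin n)) (q0 : Fin n → ℤ) (q : Fin n → ℕ → ℤ)
      (start : Fin n → ℕ),
      (∀ i, 0 ≤ q0 i) ∧ (∀ i, q i 0 = q0 i) ∧
      (∀ i t, q i (t + 1) = q i t + (if a t = some i then (p i : ℤ) else 0) - d i) ∧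
      (∀ i, ∀ t ≤ ∏ j, p j, 0 ≤ q i t) ∧
      (∀ i, q i (∏ j, p j) = q i 0) ∧
      (∀ i, ∀ t < ∏ j, p j,
        (a t = some i ↔ start i ≤ t ∧ t < start i + (∏ j, p j) * d i / p i)) := by
  have hp (i) : 0 < p i := (hd i).trans_le (hdp i)
  set C := ∏ j, p j
  set L : Fin n → ℕ := fun i => C * d i / p i
  have hLp (i) : p i * L i = C * d i :=
    Nat.mul_div_cancel' ((Finset.dvd_prod_of_mem p (Finset.mem_univ i)).mul_right (d i))
  have hLC : ∑ i, L i ≤ C := by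
    have hLq (i) : (L i : ℚ) = C * ((d i : ℚ) / p i) := by
      have hpi : (p i : ℚ) ≠ 0 := by exact_mod_cast (hp i).ne'
      have := congrArg (Nat.cast : ℕ → ℚ) (hLp i)
      push_cast at this
      field_simp
      linarith
    have : ((∑ i, L i : ℕ) : ℚ) ≤ C := by
      push_cast
      simp only [hLq, ← Finset.mul_sum]
      exact mul_le_of_le_one_right (Nat.cast_nonneg _) hsum
    exact_mod_cast this
  set s : Fin n → ℕ := fun i => ∑ k ∈ Finset.Iio i, L k
  have hsC (i) : s i + L i ≤ C := (sum_Iio_add_le_sum L i).trans hLC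
  obtain ⟨a, ha⟩ := exists_option_eq_some_iff s L fun i j => sum_Iio_add_le_sum_Iio L
  refine ⟨a, fun i => C * d i,
    fun i t => C * d i + p i * (min (t - s i) (L i) : ℕ) - d i * t, s,
    fun i => by positivity, fun i => by simp, fun i t => ?_, fun i t ht => ?_, fun i => ?_,
    fun i t _ => ha i t⟩
  · simp only [ha]
    split_ifs with h
    · have : min (t + 1 - s i) (L i) = min (t - s i) (L i) + 1 := by omega
      rw [this]
      push_cast
      ring
    · have : min (t + 1 - s i) (L i) = min (t - s i) (L i) := by omega
      rw [this]
      push_cast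
      ring
  · have h1 : (d i : ℤ) * t ≤ C * d i := by
      rw [mul_comm (C : ℤ)]
      exact_mod_cast Nat.mul_le_mul_left (d i) ht
    have h2 : (0 : ℤ) ≤ p i * (min (t - s i) (L i) : ℕ) := by positivity
    linarith
  · have h1 : min (C - s i) (L i) = L i := by
      have := hsC i
      omega
    have h2 : (p i : ℤ) * L i = C * d i := by exact_mod_cast hLp i
    simp only [h1, h2, Nat.zero_sub, Nat.zero_min, Nat.cast_zero]
    ring
end

section
/- In the Continuous-case lot-sizing model, feasibility implies ∑_{i} d i / p i ≤ 1: if for some cycle length C > 0 there exist production-rate functions f i and initial stocks q i 0 ≥ 0 forming a feasible cyclic schedule, then ∑_{i=0}^{n−1} d i / p i ≤ 1. -/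
open MeasureTheory

/-- Continuous-case lot-sizing: the existence of a feasible cyclic schedule implies
`∑ i, d i / p i ≤ 1`. -/
theorem stmt_12 (n : ℕ) (hn : 1 ≤ n) (d p : Fin n → ℝ)
    (hd : ∀ i, 0 < d i) (hp : ∀ i, 0 < p i)
    (C : ℝ) (hC : 0 < C)
    (f : Fin n → ℝ → ℝ) (hmeas : ∀ i, Measurable (f i))
    (hbnd : ∀ i, ∀ t ∈ Set.Icc (0 : ℝ) C, 0 ≤ f i t ∧ f i t ≤ p i)
    (hexcl : ∀ᵐ t ∂(volume.restrict (Set.Icc (0 : ℝ) C)),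
      ∀ i j, i ≠ j → 0 < f i t → ¬ 0 < f j t)
    (q0 : Fin n → ℝ) (hq0 : ∀ i, 0 ≤ q0 i)
    (hfeas : ∀ i, ∀ t ∈ Set.Icc (0 : ℝ) C,
      0 ≤ q0 i + (∫ u in (0 : ℝ)..t, f i u) - d i * t)
    (hcyc : ∀ i, q0 i + (∫ u in (0 : ℝ)..C, f i u) - d i * C = q0 i) :
    ∑ i, d i / p i ≤ 1 := by
  have hint : ∀ i, IntervalIntegrable (fun t => f i t / p i) volume 0 C := by
    intro i
    rw [intervalIntegrable_iff_integrableOn_Icc_of_le hC.le]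
    refine Measure.integrableOn_of_bounded (M := 1) (by simp)
      ((hmeas i).div_const _).aestronglyMeasurable ?_
    filter_upwards [ae_restrict_mem measurableSet_Icc] with t ht
    rw [Real.norm_of_nonneg (div_nonneg (hbnd i t ht).1 (hp i).le), div_le_one (hp i)]
    exact (hbnd i t ht).2
  have hutil : ∀ᵐ t ∂(volume.restrict (Set.Icc (0 : ℝ) C)), ∑ i, f i t / p i ≤ 1 := by
    filter_upwards [hexcl, ae_restrict_mem measurableSet_Icc] with t hex ht
    by_cases h : ∃ i, 0 < f i t
    · obtain ⟨i, hi⟩ := h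
      rw [Finset.sum_eq_single_of_mem i (Finset.mem_univ i), div_le_one (hp i)]
      · exact (hbnd i t ht).2
      · intro j _ hj
        rw [le_antisymm (not_lt.1 (hex i j hj.symm hi)) (hbnd j t ht).1, zero_div]
    · push Not at h
      exact (Finset.sum_nonpos fun i _ =>
        div_nonpos_of_nonpos_of_nonneg (h i) (hp i).le).trans zero_le_one
  have hsum : ∫ t in (0 : ℝ)..C, ∑ i, f i t / p i = (∑ i, d i / p i) * C := by
    rw [intervalIntegral.integral_finsetSum fun i _ => hint i, Finset.sum_mul]
    refine Finset.sum_congr rfl fun i _ => ?_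
    have hprod : ∫ u in (0 : ℝ)..C, f i u = d i * C := by linarith [hcyc i]
    rw [intervalIntegral.integral_div, hprod]
    ring
  have hle : ∫ t in (0 : ℝ)..C, ∑ i, f i t / p i ≤ ∫ _t in (0 : ℝ)..C, (1 : ℝ) :=
    intervalIntegral.integral_mono_ae_restrict hC.le
      (by simpa only [Finset.sum_fn] using IntervalIntegrable.sum Finset.univ fun i _ => hint i) intervalIntegrable_const hutil
  rw [hsum, intervalIntegral.integral_const, smul_eq_mul, mul_one, sub_zero] at hle
  exact (mul_le_iff_le_one_left hC).1 hle
end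

section
/- In the Continuous-case lot-sizing model, if ∑_{i=0}^{n−1} d i / p i ≤ 1 then for every cycle length C > 0 there exist production-rate functions f i and initial stocks q i 0 ≥ 0 forming a feasible cyclic schedule of length C (one may produce each product i at full rate p i during a block of length C·d i / p i and be idle otherwise). -/
open MeasureTheory

/-- Half-open blocks placed one after another, the `i`-th of length `L i`, are pairwise disjoint. -/
lemma notMem_consecutive_Ioc_of_lt {n : ℕ} {L : Fin n → ℝ} (hL : ∀ i, 0 ≤ L i)
    {i j : Fin n} (hij : i < j) {t : ℝ}
    (hi : t ∈ Set.Ioc (∑ k ∈ Finset.Iio i, L k) (∑ k ∈ Finset.Iic i, L k)) :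
    t ∉ Set.Ioc (∑ k ∈ Finset.Iio j, L k) (∑ k ∈ Finset.Iic j, L k) := by
  have h : ∑ k ∈ Finset.Iic i, L k ≤ ∑ k ∈ Finset.Iio j, L k :=
    Finset.sum_le_sum_of_subset_of_nonneg
      (fun k hk => Finset.mem_Iio.2 ((Finset.mem_Iic.1 hk).trans_lt hij))
      fun k _ _ => hL k
  exact fun hj => absurd (hi.2.trans h) (not_le.2 hj.1)

/-- The integral over `[0, C]` of the function with constant value `c` on a block inside `[0, C]`
and zero elsewhere. -/
lemma intervalIntegral_indicator_Ioc_const {a b C c : ℝ} (ha : 0 ≤ a) (hab : a ≤ b) (hb : b ≤ C) :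
    ∫ u in (0 : ℝ)..C, (Set.Ioc a b).indicator (fun _ => c) u = (b - a) * c := by
  rw [intervalIntegral.integral_of_le (ha.trans (hab.trans hb)),
    setIntegral_indicator measurableSet_Ioc,
    Set.inter_eq_right.2 (Set.Ioc_subset_Ioc ha hb), setIntegral_const, smul_eq_mul,
    Real.volume_real_Ioc_of_le hab]

/-- Continuous-case lot-sizing: if `∑ i, d i / p i ≤ 1` then for every cycle length
`C > 0` there exists a feasible cyclic schedule of length `C`. -/
theorem stmt_13 (n : ℕ) (hn : 1 ≤ n) (d p : Fin n → ℝ)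
    (hd : ∀ i, 0 < d i) (hp : ∀ i, 0 < p i)
    (hsum : ∑ i, d i / p i ≤ 1)
    (C : ℝ) (hC : 0 < C) :
    ∃ (f : Fin n → ℝ → ℝ) (q0 : Fin n → ℝ),
      (∀ i, Measurable (f i)) ∧
      (∀ i, ∀ t ∈ Set.Icc (0 : ℝ) C, 0 ≤ f i t ∧ f i t ≤ p i) ∧
      (∀ᵐ t ∂(volume.restrict (Set.Icc (0 : ℝ) C)),
        ∀ i j, i ≠ j → 0 < f i t → ¬ 0 < f j t) ∧
      (∀ i, 0 ≤ q0 i) ∧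
      (∀ i, ∀ t ∈ Set.Icc (0 : ℝ) C,
        0 ≤ q0 i + (∫ u in (0 : ℝ)..t, f i u) - d i * t) ∧
      (∀ i, q0 i + (∫ u in (0 : ℝ)..C, f i u) - d i * C = q0 i) := by
  let L : Fin n → ℝ := fun i => C * (d i / p i)
  have hL : ∀ i, 0 ≤ L i := fun i => mul_nonneg hC.le (div_pos (hd i) (hp i)).le
  let B : Fin n → Set ℝ := fun i =>
    Set.Ioc (∑ k ∈ Finset.Iio i, L k) (∑ k ∈ Finset.Iic i, L k)
  have hf_nonneg : ∀ i t, 0 ≤ (B i).indicator (fun _ => p i) t := fun i t =>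
    Set.indicator_nonneg (fun _ _ => (hp i).le) t
  refine ⟨fun i => (B i).indicator fun _ => p i, fun i => d i * C,
    fun i => measurable_const.indicator measurableSet_Ioc,
    fun i t _ => ⟨hf_nonneg i t, Set.indicator_le_self' (fun _ _ => (hp i).le) t⟩,
    Filter.Eventually.of_forall fun t i j hij hi hj => ?_,
    fun i => mul_nonneg (hd i).le hC.le, fun i t ht => ?_, fun i => ?_⟩
  · have hi' : t ∈ B i := Set.mem_of_indicator_ne_zero hi.ne'
    have hj' : t ∈ B j := Set.mem_of_indicator_ne_zero hj.ne'
    rcases hij.lt_or_gt with h | h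
    · exact notMem_consecutive_Ioc_of_lt hL h hi' hj'
    · exact notMem_consecutive_Ioc_of_lt hL h hj' hi'
  · have h1 : 0 ≤ ∫ u in (0 : ℝ)..t, (B i).indicator (fun _ => p i) u :=
      intervalIntegral.integral_nonneg ht.1 fun u _ => hf_nonneg i u
    have h2 : d i * t ≤ d i * C := mul_le_mul_of_nonneg_left ht.2 (hd i).le
    linarith
  · have hstep : ∑ k ∈ Finset.Iic i, L k = ∑ k ∈ Finset.Iio i, L k + L i := by
      rw [← Finset.Iio_insert, Finset.sum_insert (by simp), add_comm]
    have hend : ∑ k ∈ Finset.Iic i, L k ≤ C := calc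
      ∑ k ∈ Finset.Iic i, L k ≤ ∑ k, L k :=
        Finset.sum_le_sum_of_subset_of_nonneg (Finset.subset_univ _) fun k _ _ => hL k
      _ = C * ∑ k, d k / p k := (Finset.mul_sum _ _ _).symm
      _ ≤ C := mul_le_of_le_one_right hC.le hsum
    have hint : ∫ u in (0 : ℝ)..C, (B i).indicator (fun _ => p i) u = d i * C := by
      rw [intervalIntegral_indicator_Ioc_const (Finset.sum_nonneg fun k _ => hL k)
        (by linarith [hL i]) hend, hstep, add_sub_cancel_left, mul_assoc,
        div_mul_cancel₀ _ (hp i).ne', mul_comm]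
    linarith
end

section
/- In the multi-product Discrete-case lot-sizing model with switching costs, no schedule with idle time is optimal: for every feasible cyclic schedule of length C that is idle during at least one time unit (a t = none for some t < C, while some production occurs during the cycle), there exists a feasible cyclic schedule of the same length C whose switching cost is no larger and whose total holding cost is strictly smaller; hence its total cost (holding plus switching) is strictly smaller. -/
open Finset

/-- Stock of product `i` at time `t` in the Discrete-case multi-product model:
`q i 0 = q0 i` and `q i (t+1) = q i t + (if a t = some i then π t else 0) - d i`. -/
def discreteStock {n : ℕ} (d : Fin n → ℝ) (a : ℕ → Option (Fin n)) (π : ℕ → ℝ)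
    (q0 : Fin n → ℝ) (i : Fin n) : ℕ → ℝ
  | 0 => q0 i
  | t + 1 => discreteStock d a π q0 i t + (if a t = some i then π t else 0) - d i

/-- A feasible cyclic schedule of length `C` in the Discrete-case multi-product model:
production amounts are nonnegative, bounded by the production rate of the scheduled
product, zero during idle time units; initial stocks are nonnegative, all stocks stay
nonnegative throughout the cycle, and the stocks at time `C` equal the initial stocks. -/
def DiscreteFeasibleCyclic {n : ℕ} (d p : Fin n → ℝ) (C : ℕ) (a : ℕ → Option (Fin n))
    (π : ℕ → ℝ) (q0 : Fin n → ℝ) : Prop :=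
  (∀ t, 0 ≤ π t) ∧
  (∀ t i, a t = some i → π t ≤ p i) ∧
  (∀ t, a t = none → π t = 0) ∧
  (∀ i, 0 ≤ q0 i) ∧
  (∀ i, ∀ t ≤ C, 0 ≤ discreteStock d a π q0 i t) ∧
  (∀ i, discreteStock d a π q0 i C = q0 i)

/-- Total holding cost of a schedule of length `C`: `∑_{t<C} ∑_i h i * q i (t+1)`. -/
noncomputable def discreteHoldingCost {n : ℕ} (h d : Fin n → ℝ) (C : ℕ)
    (a : ℕ → Option (Fin n)) (π : ℕ → ℝ) (q0 : Fin n → ℝ) : ℝ :=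
  ∑ t ∈ Finset.range C, ∑ i, h i * discreteStock d a π q0 i (t + 1)

/-- The number of steps from `t` to the first production time unit strictly after `t`
in cyclic order (and `0` if the machine is never producing). -/
def nextProdStep {n : ℕ} (C : ℕ) (a : ℕ → Option (Fin n)) (t : ℕ) : ℕ :=
  ((Finset.Icc 1 C).filter (fun k => (a ((t + k) % C)).isSome)).min.getD 0

/-- Total switching cost of a schedule of length `C`: the sum, over all time units
`t < C` in which some product `i` is produced, of `s i j`, where `j` is the product
produced at the first production time unit strictly after `t` in cyclic order. -/
noncomputable def discreteSwitchCost {n : ℕ} (s : Fin n → Fin n → ℝ) (C : ℕ)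
    (a : ℕ → Option (Fin n)) : ℝ :=
  ∑ t ∈ Finset.range C,
    match a t, a ((t + nextProdStep C a t) % C) with
    | some i, some j => s i j
    | _, _ => 0

/-- A predicate on `ℕ` that holds somewhere below `x` holds at a last place below `x`. -/
lemma forall_not_or_exists_last_lt (P : ℕ → Prop) (x : ℕ) :
    (∀ t < x, ¬ P t) ∨ ∃ u < x, P u ∧ ∀ t, u < t → t < x → ¬ P t := by
  induction x with
  | zero => left; intro t ht; omega
  | succ x ih =>
    by_cases hx : P x
    · exact Or.inr ⟨x, by omega, hx, fun t h₁ h₂ => by omega⟩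
    · rcases ih with ih | ⟨u, hu, hPu, ih⟩
      · left
        intro t ht
        rcases Nat.lt_succ_iff_lt_or_eq.mp ht with h | rfl
        exacts [ih t h, hx]
      · refine Or.inr ⟨u, by omega, hPu, fun t h₁ h₂ => ?_⟩
        rcases Nat.lt_succ_iff_lt_or_eq.mp h₂ with h | rfl
        exacts [ih t h₁ h, hx]

section NextProduction

variable {n C : ℕ} {a : ℕ → Option (Fin n)}

/-- If some production occurs in the cycle, `nextProdStep` is the least positive number of
steps after which a production time unit is reached. -/
lemma nextProdStep_spec (hprod : ∃ t < C, (a t).isSome = true) (t : ℕ) :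
    1 ≤ nextProdStep C a t ∧ nextProdStep C a t ≤ C ∧
      (a ((t + nextProdStep C a t) % C)).isSome = true ∧
      ∀ m, 1 ≤ m → m < nextProdStep C a t → a ((t + m) % C) = none := by
  obtain ⟨r, hr, har⟩ := hprod
  have hC : 0 < C := by omega
  have hmod : t % C < C := Nat.mod_lt _ hC
  obtain ⟨k, hk1, hkC, hk⟩ : ∃ k, 1 ≤ k ∧ k ≤ C ∧ (t + k) % C = r := by
    rcases lt_or_ge (t % C) r with h | h
    · refine ⟨r - t % C, by omega, by omega, ?_⟩
      rw [Nat.add_mod, Nat.mod_eq_of_lt (a := r - t % C) (by omega),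
        Nat.add_sub_cancel' h.le, Nat.mod_eq_of_lt hr]
    · refine ⟨C + r - t % C, by omega, by omega, ?_⟩
      rw [← Nat.mod_add_mod, Nat.add_sub_cancel' (by omega), Nat.add_mod_left,
        Nat.mod_eq_of_lt hr]
  set F := (Finset.Icc 1 C).filter (fun k => (a ((t + k) % C)).isSome) with hF
  have hkF : k ∈ F := by
    rw [hF, Finset.mem_filter, Finset.mem_Icc, hk]
    exact ⟨⟨hk1, hkC⟩, har⟩
  obtain ⟨m, hm⟩ := Finset.min_of_mem hkF
  have hstep : nextProdStep C a t = m := by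
    unfold nextProdStep
    rw [← hF, hm]
    rfl
  have hmF := Finset.mem_of_min hm
  rw [hF, Finset.mem_filter, Finset.mem_Icc] at hmF
  rw [hstep]
  refine ⟨hmF.1.1, hmF.1.2, hmF.2, fun l hl1 hlm => ?_⟩
  by_contra hne
  have hlF : l ∈ F := by
    rw [hF, Finset.mem_filter, Finset.mem_Icc]
    exact ⟨⟨hl1, by omega⟩, Option.isSome_iff_ne_none.mpr hne⟩
  have := Finset.min_le_of_eq hlF hm
  omega

lemma nextProdStep_eq (hprod : ∃ t < C, (a t).isSome = true) {t k : ℕ} (hk : 1 ≤ k)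
    (hsome : (a ((t + k) % C)).isSome = true)
    (hnone : ∀ m, 1 ≤ m → m < k → a ((t + m) % C) = none) :
    nextProdStep C a t = k := by
  obtain ⟨h1, -, hs, hn⟩ := nextProdStep_spec hprod t
  rcases lt_trichotomy (nextProdStep C a t) k with h | h | h
  · simp [hnone _ h1 h] at hs
  · exact h
  · simp [hn k hk h] at hsome

/-- Filling an idle time unit with the product that is produced next does not change the
product produced next after any time unit. -/
lemma next_product_update (hprod : ∃ t < C, (a t).isSome = true) {τ : ℕ}
    (hτ : a τ = none) {i : Fin n} (hi : a ((τ + nextProdStep C a τ) % C) = some i) (t : ℕ) :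
    Function.update a τ (some i)
        ((t + nextProdStep C (Function.update a τ (some i)) t) % C) =
      a ((t + nextProdStep C a t) % C) := by
  have hprod' : ∃ t < C, (Function.update a τ (some i) t).isSome = true := by
    obtain ⟨r, hr, har⟩ := hprod
    refine ⟨r, hr, ?_⟩
    rw [Function.update_of_ne (by rintro rfl; simp [hτ] at har)]
    exact har
  obtain ⟨h1, -, hs, hn⟩ := nextProdStep_spec hprod' t
  set k := nextProdStep C (Function.update a τ (some i)) t
  have hnone : ∀ m, 1 ≤ m → m < k → a ((t + m) % C) = none := by
    intro m hm hmk
    have := hn m hm hmk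
    by_cases h : (t + m) % C = τ
    · rw [h, hτ]
    · rwa [Function.update_of_ne h] at this
  by_cases h : (t + k) % C = τ
  · obtain ⟨h1', -, hs', hn'⟩ := nextProdStep_spec hprod τ
    have hshift : ∀ m, (t + (k + m)) % C = (τ + m) % C := by
      intro m
      rw [← add_assoc, ← Nat.mod_add_mod, h]
    have : nextProdStep C a t = k + nextProdStep C a τ := by
      refine nextProdStep_eq hprod (by omega) ?_ ?_
      · rwa [hshift]
      · intro m hm hmk
        rcases lt_trichotomy m k with hlt | rfl | hgt
        · exact hnone m hm hlt
        · rw [h, hτ]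
        · obtain ⟨l, rfl⟩ := Nat.exists_eq_add_of_lt hgt
          rw [add_assoc, hshift]
          exact hn' _ (by omega) (by omega)
    rw [this, hshift, hi, h, Function.update_self]
  · rw [Function.update_of_ne h] at hs ⊢
    rw [nextProdStep_eq hprod h1 hs hnone]

lemma discreteSwitchCost_update (s : Fin n → Fin n → ℝ) (hsii : ∀ i, s i i = 0)
    (hprod : ∃ t < C, (a t).isSome = true) {τ : ℕ} (hτ : a τ = none) {i : Fin n}
    (hi : a ((τ + nextProdStep C a τ) % C) = some i) :
    discreteSwitchCost s C (Function.update a τ (some i)) = discreteSwitchCost s C a := by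
  unfold discreteSwitchCost
  refine Finset.sum_congr rfl fun t _ => ?_
  rw [next_product_update hprod hτ hi t]
  by_cases h : t = τ
  · subst h
    simp [hi, hτ, hsii]
  · rw [Function.update_of_ne h]

end NextProduction

section Stock

variable {n : ℕ} {d : Fin n → ℝ} {a : ℕ → Option (Fin n)} {π : ℕ → ℝ} {q0 : Fin n → ℝ}

lemma discreteStock_antitone_of_no_production (hd : ∀ i, 0 < d i) (i : Fin n) {x y : ℕ}
    (hxy : x ≤ y) (h : ∀ t, x ≤ t → t < y → ¬ (a t = some i ∧ 0 < π t)) :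
    discreteStock d a π q0 i y ≤ discreteStock d a π q0 i x := by
  induction y, hxy using Nat.le_induction with
  | base => exact le_rfl
  | succ y hxy ih =>
    have ih := ih fun t h₁ h₂ => h t h₁ (by omega)
    have hy := h y hxy (by omega)
    have hdi := hd i
    rw [discreteStock]
    split_ifs with hay
    · have : π y ≤ 0 := not_lt.mp fun hpos => hy ⟨hay, hpos⟩
      linarith
    · linarith

/-- For a product `i` and an idle time unit `τ`, the stock of `i` is at least `d i` on the
cyclic interval from just after the last production of `i` before `τ` up to `τ`. -/
lemma exists_last_production {p : Fin n → ℝ} {C : ℕ} (hd : ∀ i, 0 < d i)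
    (hfeas : DiscreteFeasibleCyclic d p C a π q0) {τ : ℕ} (hτC : τ < C) (hτ : a τ = none)
    (i : Fin n) :
    ∃ u < C, u ≠ τ ∧ a u = some i ∧ 0 < π u ∧ ∀ t ≤ C,
      (u < t ∧ t ≤ τ) ∨ (τ < u ∧ (t ≤ τ ∨ u < t)) → d i ≤ discreteStock d a π q0 i t := by
  obtain ⟨-, -, -, -, hq, hcyc⟩ := hfeas
  have hstep : discreteStock d a π q0 i (τ + 1) = discreteStock d a π q0 i τ - d i := by
    simp [discreteStock, hτ]
  have hqτ : d i ≤ discreteStock d a π q0 i τ := by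
    have := hq i (τ + 1) hτC
    linarith
  rcases forall_not_or_exists_last_lt (fun t => a t = some i ∧ 0 < π t) τ with
    hA | ⟨u, hu, ⟨hau, hpu⟩, hlast⟩
  · have hbefore : ∀ t ≤ τ, d i ≤ discreteStock d a π q0 i t := fun t ht =>
      hqτ.trans (discreteStock_antitone_of_no_production hd i ht fun r _ hr => hA r hr)
    have hstart : d i ≤ discreteStock d a π q0 i C := by
      rw [hcyc i]
      exact hbefore 0 (Nat.zero_le _)
    rcases forall_not_or_exists_last_lt (fun t => a t = some i ∧ 0 < π t) C with
      hB | ⟨u, hu, ⟨hau, hpu⟩, hlast⟩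
    · have h₁ := discreteStock_antitone_of_no_production (q0 := q0) hd i
        (Nat.succ_le_of_lt hτC) fun r _ hr => hB r hr
      have h₂ := discreteStock_antitone_of_no_production (q0 := q0) hd i
        (Nat.zero_le τ) fun r _ hr => hA r hr
      rw [hcyc i, Nat.succ_eq_add_one, hstep] at h₁
      rw [discreteStock] at h₂
      linarith [hd i]
    · have hne : u ≠ τ := by rintro rfl; simp [hτ] at hau
      have hgt : τ < u := by
        by_contra hle
        exact hA u (by omega) ⟨hau, hpu⟩
      refine ⟨u, hu, hne, hau, hpu, fun t htC ht => ?_⟩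
      rcases le_or_gt t τ with htτ | htτ
      · exact hbefore t htτ
      · exact hstart.trans (discreteStock_antitone_of_no_production hd i htC
          fun r hr₁ hr₂ => hlast r (by omega) hr₂)
  · refine ⟨u, hu.trans hτC, hu.ne, hau, hpu, fun t _ ht => ?_⟩
    exact hqτ.trans (discreteStock_antitone_of_no_production hd i (by omega)
      fun r hr₁ hr₂ => hlast r (by omega) hr₂)

/-- The effect on the stocks of moving an amount `ε` of the production of `i` from time `u`
to the idle time `τ`, with initial stock of `i` changed by `δ`. -/
lemma discreteStock_move {u τ : ℕ} {i : Fin n} (hne : u ≠ τ) (hau : a u = some i)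
    (hτ : a τ = none) (ε δ : ℝ) (j : Fin n) (t : ℕ) :
    discreteStock d (Function.update a τ (some i))
        (Function.update (Function.update π τ ε) u (π u - ε))
        (Function.update q0 i (q0 i + δ)) j t =
      discreteStock d a π q0 j t +
        if j = i then δ - (if u < t then ε else 0) + (if τ < t then ε else 0) else 0 := by
  induction t with
  | zero =>
    by_cases hj : j = i
    · subst hj; simp [discreteStock]
    · simp [discreteStock, hj]
  | succ t ih =>
    rw [discreteStock, discreteStock, ih]
    by_cases htu : t = u
    · subst htu
      rw [Function.update_of_ne hne, Function.update_self, hau]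
      by_cases hj : j = i
      · subst hj
        have : (τ < t + 1) ↔ τ < t := by omega
        simp [this]
        ring
      · simp [hj, Ne.symm hj]
    · have hu : (u < t + 1) ↔ u < t := by omega
      rw [Function.update_of_ne htu]
      by_cases htτ : t = τ
      · subst htτ
        rw [Function.update_self, Function.update_self, hτ]
        by_cases hj : j = i
        · subst hj
          simp [hu]
          ring
        · simp [hj, Ne.symm hj]
      · have hτt : (τ < t + 1) ↔ τ < t := by omega
        rw [Function.update_of_ne htτ, Function.update_of_ne htτ]
        simp only [hu, hτt]
        ring

end Stock

/-- Multi-product Discrete-case lot-sizing with switching costs: no schedule with idle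
time is optimal.  Any feasible cyclic schedule of length `C` that is idle during some
time unit (while some production occurs during the cycle) is strictly beaten by another
feasible cyclic schedule of the same length, with no larger switching cost, strictly
smaller holding cost, and hence strictly smaller total cost. -/
theorem stmt_14 {n : ℕ} (hn : 1 ≤ n) (d p h : Fin n → ℝ) (s : Fin n → Fin n → ℝ)
    (hd : ∀ i, 0 < d i) (hdp : ∀ i, d i ≤ p i) (hh : ∀ i, 0 < h i)
    (hs : ∀ i j, 0 ≤ s i j) (hsii : ∀ i, s i i = 0)
    (C : ℕ) (hC : 0 < C) (a : ℕ → Option (Fin n)) (π : ℕ → ℝ) (q0 : Fin n → ℝ)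
    (hfeas : DiscreteFeasibleCyclic d p C a π q0)
    (hidle : ∃ t < C, a t = none)
    (hprod : ∃ t < C, (a t).isSome = true) :
    ∃ (a' : ℕ → Option (Fin n)) (π' : ℕ → ℝ) (q0' : Fin n → ℝ),
      DiscreteFeasibleCyclic d p C a' π' q0' ∧
      discreteSwitchCost s C a' ≤ discreteSwitchCost s C a ∧
      discreteHoldingCost h d C a' π' q0' < discreteHoldingCost h d C a π q0 ∧
      discreteHoldingCost h d C a' π' q0' + discreteSwitchCost s C a'
        < discreteHoldingCost h d C a π q0 + discreteSwitchCost s C a := by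
  obtain ⟨τ, hτC, hτ⟩ := hidle
  obtain ⟨i, hi⟩ := Option.isSome_iff_exists.mp (nextProdStep_spec hprod τ).2.2.1
  obtain ⟨u, huC, hne, hau, hpu, hstock⟩ := exists_last_production hd hfeas hτC hτ i
  obtain ⟨hπ, hπp, hπ0, hq0, hq, hcyc⟩ := hfeas
  obtain ⟨ε, hε, hεu, hεd⟩ : ∃ ε, 0 < ε ∧ ε ≤ π u ∧ ε ≤ d i :=
    ⟨min (π u) (d i), lt_min hpu (hd i), min_le_left _ _, min_le_right _ _⟩
  set δ : ℝ := if u < τ then 0 else -ε with hδ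
  set a' := Function.update a τ (some i) with ha'
  set π' := Function.update (Function.update π τ ε) u (π u - ε) with hπ'
  set q0' := Function.update q0 i (q0 i + δ) with hq0'
  have hmove := discreteStock_move (d := d) (π := π) (q0 := q0) hne hau hτ ε δ
  simp only [← ha', ← hπ', ← hq0'] at hmove
  have hle : ∀ j t, discreteStock d a' π' q0' j t ≤ discreteStock d a π q0 j t := by
    intro j t
    rw [hmove, hδ]
    split_ifs <;> linarith
  have hnonneg : ∀ j, ∀ t ≤ C, 0 ≤ discreteStock d a' π' q0' j t := by
    intro j t ht
    have h₀ := hq j t ht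
    rw [hmove]
    by_cases hj : j = i
    · subst hj
      by_cases hS : (u < t ∧ t ≤ τ) ∨ (τ < u ∧ (t ≤ τ ∨ u < t))
      · have := hstock t ht hS
        rw [hδ]
        split_ifs <;> linarith
      · rw [hδ]
        split_ifs <;> first | linarith | omega
    · simpa [hj] using h₀
  have hcyc' : ∀ j, discreteStock d a' π' q0' j C = q0' j := by
    intro j
    rw [hmove, hcyc, hq0']
    by_cases hj : j = i
    · subst hj
      simp [huC, hτC]
    · simp [hj]
  have hfeas' : DiscreteFeasibleCyclic d p C a' π' q0' := by
    refine ⟨fun t => ?_, fun t j hj => ?_, fun t ht => ?_, fun j => hnonneg j 0 (Nat.zero_le _),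
      hnonneg, hcyc'⟩
    · simp only [hπ', Function.update_apply]
      split_ifs
      exacts [by linarith, hε.le, hπ t]
    · by_cases htτ : t = τ
      · subst htτ
        rw [ha', Function.update_self] at hj
        cases hj
        rw [hπ', Function.update_of_ne hne.symm, Function.update_self]
        exact hεd.trans (hdp i)
      · rw [ha', Function.update_of_ne htτ] at hj
        have := hπp t j hj
        rw [hπ', Function.update_apply]
        split_ifs with htu
        · subst htu
          linarith
        · rwa [Function.update_of_ne htτ]
    · have htτ : t ≠ τ := by
        rintro rfl
        simp [ha'] at ht
      rw [ha', Function.update_of_ne htτ] at ht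
      have htu : t ≠ u := by
        rintro rfl
        simp [hau] at ht
      rw [hπ', Function.update_of_ne htu, Function.update_of_ne htτ]
      exact hπ0 t ht
  have hswitch : discreteSwitchCost s C a' = discreteSwitchCost s C a :=
    discreteSwitchCost_update s hsii hprod hτ hi
  have hhold : discreteHoldingCost h d C a' π' q0' < discreteHoldingCost h d C a π q0 := by
    unfold discreteHoldingCost
    have hterm : ∀ t j, h j * discreteStock d a' π' q0' j (t + 1) ≤
        h j * discreteStock d a π q0 j (t + 1) := fun t j =>
      mul_le_mul_of_nonneg_left (hle j (t + 1)) (hh j).le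
    refine Finset.sum_lt_sum (fun t _ => Finset.sum_le_sum fun j _ => hterm t j)
      ⟨u, Finset.mem_range.mpr huC, Finset.sum_lt_sum (fun j _ => hterm u j)
        ⟨i, Finset.mem_univ i, mul_lt_mul_of_pos_left ?_ (hh i)⟩⟩
    rw [hmove, hδ]
    split_ifs <;> first | linarith | omega
  exact ⟨a', π', q0', hfeas', hswitch.le, hhold, by linarith⟩
end
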